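/- arXiv:1802.09205 — 2 statements merged into one kernel-verified Lean document; each statement's English description precedes it below -/
import Mathlib

section
/- Let X be a finite nonempty subset of a metric space, let (t_1, ..., t_m) be a greedy (GMM) sequence in X with T = {t_1, ..., t_m}, and let x ∈ X be a point at maximum distance from T, i.e. d(x, T) = r_T(X). Then any two distinct points of T ∪ {x} are at distance at least r_T(X) from one another. -/
/-- Distance-based radius of a finite set `S` with respect to a finite set
of centers `T`: `r_T(S) = max_{s ∈ S} d(s, T)`. -/
noncomputable def radius {α : Type*} [MetricSpace α] (S T : Finset α) : ℝ :=
  sSup ((fun s => Metric.infDist s (T : Set α)) '' (S : Set α))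

/-- Optimal radius of the `k`-center problem on `S`. -/
noncomputable def optRadius {α : Type*} [MetricSpace α] (S : Finset α) (k : ℕ) : ℝ :=
  sInf ((fun T => radius S T) '' {T : Finset α | T ⊆ S ∧ T.card = k})

/-- Optimal radius of the `k`-center problem with `z` outliers on `S`. -/
noncomputable def optRadiusOut {α : Type*} [MetricSpace α] [DecidableEq α]
    (S : Finset α) (k z : ℕ) : ℝ :=
  sInf {r : ℝ | ∃ T Z : Finset α, T ⊆ S ∧ T.card = k ∧ Z ⊆ S ∧ Z.card = z ∧
    radius (S \ Z) T = r}

/-- `t : ℕ → α` is a greedy (GMM) sequence in the finite set `X`: `t 0 ∈ X` and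
each `t (j+1)` is a point of `X` at maximum distance from `{t 0, …, t j}`. -/
def IsGMM {α : Type*} [MetricSpace α] [DecidableEq α] (X : Finset α) (t : ℕ → α) : Prop :=
  t 0 ∈ X ∧ ∀ j : ℕ, t (j + 1) ∈ X ∧ ∀ x ∈ X,
    Metric.infDist x (((Finset.range (j + 1)).image t : Finset α) : Set α) ≤
      Metric.infDist (t (j + 1)) (((Finset.range (j + 1)).image t : Finset α) : Set α)

/-- A metric space has doubling dimension at most `D` if every closed ball of
radius `r` is covered by at most `2^D` closed balls of radius `r/2`. -/
def DoublingDimLE (α : Type*) [MetricSpace α] (D : ℕ) : Prop :=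
  ∀ (x : α) (r : ℝ), 0 < r → ∃ Y : Finset α, Y.card ≤ 2 ^ D ∧
    Metric.closedBall x r ⊆ ⋃ y ∈ Y, Metric.closedBall y (r / 2)

/-- A point of `X` is at least as close to a GMM prefix as any two points of the prefix are
to one another. -/
theorem IsGMM.infDist_le_dist {α : Type*} [MetricSpace α] [DecidableEq α] {X : Finset α}
    {t : ℕ → α} (ht : IsGMM X t) {m i j : ℕ} (hij : i < j) (hjm : j < m) {x : α} (hx : x ∈ X) :
    Metric.infDist x (((Finset.range m).image t : Finset α) : Set α) ≤ dist (t i) (t j) := by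
  obtain ⟨k, rfl⟩ : ∃ k, j = k + 1 := ⟨j - 1, by omega⟩
  have hi : t i ∈ (((Finset.range (k + 1)).image t : Finset α) : Set α) :=
    Finset.mem_coe.2 (Finset.mem_image_of_mem t (Finset.mem_range.2 hij))
  calc Metric.infDist x (((Finset.range m).image t : Finset α) : Set α)
      ≤ Metric.infDist x (((Finset.range (k + 1)).image t : Finset α) : Set α) :=
        Metric.infDist_le_infDist_of_subset
          (Finset.coe_subset.2 (Finset.image_subset_image (Finset.range_mono hjm.le))) ⟨_, hi⟩
    _ ≤ Metric.infDist (t (k + 1)) (((Finset.range (k + 1)).image t : Finset α) : Set α) :=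
        (ht.2 k).2 x hx
    _ ≤ dist (t (k + 1)) (t i) := Metric.infDist_le_dist_of_mem hi
    _ = dist (t i) (t (k + 1)) := dist_comm _ _

/-- in a greedy (GMM) prefix `T` of `X` together with any point
`x ∈ X` at maximum distance from `T`, all pairwise distances are at least
`r_T(X)`. -/
theorem gmm_prefix_separated {α : Type*} [MetricSpace α] [DecidableEq α]
    (X : Finset α) (hX : X.Nonempty) (t : ℕ → α) (ht : IsGMM X t)
    (m : ℕ) (hm : 1 ≤ m) (T : Finset α) (hT : T = (Finset.range m).image t)
    (x : α) (hx : x ∈ X)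
    (hxmax : Metric.infDist x (T : Set α) = radius X T) :
    ∀ a ∈ T ∪ {x}, ∀ b ∈ T ∪ {x}, a ≠ b → radius X T ≤ dist a b := by
  intro a ha b hb hab
  rw [← hxmax]
  simp only [Finset.mem_union, Finset.mem_singleton] at ha hb
  rcases ha with ha | rfl <;> rcases hb with hb | rfl
  · subst hT
    obtain ⟨i, hi, rfl⟩ := Finset.mem_image.1 ha
    obtain ⟨j, hj, rfl⟩ := Finset.mem_image.1 hb
    rw [Finset.mem_range] at hi hj
    rcases lt_trichotomy i j with h | rfl | h
    · exact ht.infDist_le_dist h hj hx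
    · exact absurd rfl hab
    · rw [dist_comm]
      exact ht.infDist_le_dist h hi hx
  · rw [dist_comm]
    exact Metric.infDist_le_dist_of_mem (Finset.mem_coe.2 ha)
  · exact Metric.infDist_le_dist_of_mem (Finset.mem_coe.2 hb)
  · exact absurd rfl hab
end

section
/- Let M be a metric space of doubling dimension at most D, let X be a finite nonempty subset of M, and suppose there are k points c_1, ..., c_k of M and a radius R ≥ 0 such that every point of X is within distance R of some c_i. Let 0 < ε ≤ 1, set h = k · 2^{D·⌈log₂(4/ε)⌉}, and let m = min(h, |X|). Then the set T^m consisting of the first m points of any greedy (GMM) sequence in X satisfies r_{T^m}(X) ≤ (ε/2) · R. Consequently, the smallest index τ for which a greedy sequence prefix T^τ in X satisfies r_{T^τ}(X) ≤ (ε/2) · R is at most k · 2^{D·⌈log₂(4/ε)⌉}. -/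
/-- Iterating the doubling property `n` times: a closed ball of radius `r` is covered by at most
`2 ^ (D * n)` closed balls of radius `r / 2 ^ n`. -/
theorem DoublingDimLE.exists_cover {α : Type*} [MetricSpace α] {D : ℕ} (hD : DoublingDimLE α D)
    (x : α) {r : ℝ} (hr : 0 ≤ r) (n : ℕ) :
    ∃ Y : Finset α, Y.card ≤ 2 ^ (D * n) ∧
      ∀ z, dist z x ≤ r → ∃ y ∈ Y, dist z y ≤ r / 2 ^ n := by
  classical
  induction n with
  | zero => exact ⟨{x}, by simp, fun z hz => ⟨x, by simp, by simpa using hz⟩⟩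
  | succ n ih =>
    obtain ⟨Y, hcard, hY⟩ := ih
    have hhalf : ∀ y : α, ∃ Z : Finset α, Z.card ≤ 2 ^ D ∧
        ∀ z, dist z y ≤ r / 2 ^ n → ∃ w ∈ Z, dist z w ≤ r / 2 ^ (n + 1) := by
      intro y
      rcases hr.eq_or_lt with rfl | hr
      · exact ⟨{y}, by simpa using Nat.one_le_two_pow,
          fun z hz => ⟨y, by simp, by simpa using hz⟩⟩
      · obtain ⟨Z, hZ, hsub⟩ := hD y (r / 2 ^ n) (by positivity)
        refine ⟨Z, hZ, fun z hz => ?_⟩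
        have hmem := hsub (Metric.mem_closedBall.2 hz)
        simp only [Set.mem_iUnion, Metric.mem_closedBall] at hmem
        obtain ⟨w, hw, hzw⟩ := hmem
        exact ⟨w, hw, by rwa [pow_succ, ← div_div]⟩
    choose F hF hFcov using hhalf
    refine ⟨Y.biUnion F, ?_, fun z hz => ?_⟩
    · calc (Y.biUnion F).card ≤ Y.card * 2 ^ D := Finset.card_biUnion_le_card_mul _ _ _ fun y _ => hF y
        _ ≤ 2 ^ (D * n) * 2 ^ D := Nat.mul_le_mul_right _ hcard
        _ = 2 ^ (D * (n + 1)) := by rw [mul_add, pow_add, mul_one]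
    · obtain ⟨y, hy, hzy⟩ := hY z hz
      obtain ⟨w, hw, hzw⟩ := hFcov y z hzy
      exact ⟨w, Finset.mem_biUnion.2 ⟨y, hy, hw⟩, hzw⟩

theorem IsGMM.mem {α : Type*} [MetricSpace α] [DecidableEq α] {X : Finset α} {t : ℕ → α}
    (ht : IsGMM X t) : ∀ j, t j ∈ X
  | 0 => ht.1
  | j + 1 => (ht.2 j).1

/-- If some point of `X` is farther than `δ` from the first `m` points of a greedy sequence, then
the first `m + 1` points are pairwise at distance more than `δ`. -/
theorem IsGMM.lt_dist {α : Type*} [MetricSpace α] [DecidableEq α] {X : Finset α} {t : ℕ → α}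
    (ht : IsGMM X t) {m : ℕ} {δ : ℝ} {x : α} (hx : x ∈ X)
    (hδ : δ < Metric.infDist x (((Finset.range m).image t : Finset α) : Set α))
    {i j : ℕ} (hij : i < j) (hj : j ≤ m) : δ < dist (t j) (t i) := by
  obtain ⟨j, rfl⟩ : ∃ l, j = l + 1 := ⟨j - 1, by omega⟩
  have hmem : t i ∈ (((Finset.range (j + 1)).image t : Finset α) : Set α) :=
    Finset.mem_coe.2 (Finset.mem_image_of_mem t (Finset.mem_range.2 hij))
  calc δ < Metric.infDist x (((Finset.range m).image t : Finset α) : Set α) := hδ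
    _ ≤ Metric.infDist x (((Finset.range (j + 1)).image t : Finset α) : Set α) :=
      Metric.infDist_le_infDist_of_subset
        (Finset.coe_subset.2 (Finset.image_subset_image (Finset.range_mono hj))) ⟨_, hmem⟩
    _ ≤ Metric.infDist (t (j + 1)) (((Finset.range (j + 1)).image t : Finset α) : Set α) :=
      (ht.2 j).2 x hx
    _ ≤ dist (t (j + 1)) (t i) := Metric.infDist_le_dist_of_mem hmem

/-- If `X` is covered by at most `m` closed balls of radius `δ / 2`, then the first `m` points of a
greedy sequence in `X` have radius at most `δ`. -/
theorem IsGMM.radius_le_of_cover {α : Type*} [MetricSpace α] [DecidableEq α] {X : Finset α}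
    {t : ℕ → α} (ht : IsGMM X t) {m : ℕ} {δ : ℝ} (hδ : 0 ≤ δ) {Y : Finset α} (hY : Y.card ≤ m)
    (hcov : ∀ x ∈ X, ∃ y ∈ Y, dist x y ≤ δ / 2) :
    radius X ((Finset.range m).image t) ≤ δ := by
  refine Real.sSup_le ?_ hδ
  rintro _ ⟨x, hx, rfl⟩
  by_contra! hlt
  have hsep {i j : ℕ} (hij : i < j) (hj : j ≤ m) : δ < dist (t j) (t i) :=
    ht.lt_dist (Finset.mem_coe.1 hx) hlt hij hj
  choose f hfY hf using fun i : ℕ => hcov (t i) (ht.mem i)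
  obtain ⟨i, hi, j, hj, hne, hfij⟩ := Finset.exists_ne_map_eq_of_card_lt_of_maps_to
    (s := Finset.range (m + 1)) (t := Y) (f := f) (by simp; omega) (fun i _ => hfY i)
  rw [Finset.mem_range] at hi hj
  have hclose : dist (t j) (t i) ≤ δ := by
    have htri := dist_triangle_right (t j) (t i) (f i)
    have hfj := hf j
    rw [← hfij] at hfj
    linarith [hf i]
  rcases hne.lt_or_gt with h | h
  · exact absurd (hsep h (by omega)) (not_lt.2 hclose)
  · exact absurd (hsep h (by omega)) (not_lt.2 (dist_comm (t j) (t i) ▸ hclose))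

/-- Lemma 3.2: if `X` is covered by `k` balls of radius `R` in a
space of doubling dimension at most `D`, then after
`m = min(k · 2^(D·⌈log₂(4/ε)⌉), |X|)` steps, GMM achieves radius at most
`(ε/2)·R`; hence the smallest such prefix length is at most
`k · 2^(D·⌈log₂(4/ε)⌉)`. -/
theorem gmm_coreset_size {α : Type*} [MetricSpace α] [DecidableEq α]
    (D : ℕ) (hD : DoublingDimLE α D)
    (X : Finset α) (hX : X.Nonempty)
    (k : ℕ) (hk : 0 < k) (c : Fin k → α) (R : ℝ) (hR : 0 ≤ R)
    (hcov : ∀ x ∈ X, ∃ i : Fin k, dist x (c i) ≤ R)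
    (ε : ℝ) (hε : 0 < ε) (hε1 : ε ≤ 1)
    (t : ℕ → α) (ht : IsGMM X t) :
    radius X
        ((Finset.range (min (k * 2 ^ (D * ⌈Real.logb 2 (4 / ε)⌉₊)) X.card)).image t)
      ≤ ε / 2 * R ∧
    ∃ τ ≤ k * 2 ^ (D * ⌈Real.logb 2 (4 / ε)⌉₊),
      radius X ((Finset.range τ).image t) ≤ ε / 2 * R := by
  set n := ⌈Real.logb 2 (4 / ε)⌉₊ with hn
  have hδ : 0 ≤ ε / 2 * R := by positivity
  have hpow : 4 / ε ≤ 2 ^ n := by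
    rw [← Real.rpow_natCast, ← Real.logb_le_iff_le_rpow one_lt_two (by positivity)]
    exact Nat.le_ceil _
  have hscale : R / 2 ^ n ≤ ε / 2 * R / 2 := by
    rw [div_le_iff₀ hε] at hpow
    rw [div_le_iff₀ (by positivity)]
    nlinarith
  have hmain : radius X ((Finset.range (min (k * 2 ^ (D * n)) X.card)).image t) ≤ ε / 2 * R := by
    rcases min_choice (k * 2 ^ (D * n)) X.card with h | h <;> rw [h]
    · choose F hF hFcov using fun i => hD.exists_cover (c i) hR n
      refine ht.radius_le_of_cover hδ (Y := Finset.univ.biUnion F) ?_ fun x hx => ?_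
      · simpa using Finset.card_biUnion_le_card_mul Finset.univ F _ fun i _ => hF i
      · obtain ⟨i, hi⟩ := hcov x hx
        obtain ⟨y, hy, hxy⟩ := hFcov i x hi
        exact ⟨y, Finset.mem_biUnion.2 ⟨i, Finset.mem_univ i, hy⟩, hxy.trans hscale⟩
    · exact ht.radius_le_of_cover hδ le_rfl fun x hx => ⟨x, hx, by rw [dist_self]; positivity⟩
  exact ⟨hmain, _, min_le_left _ _, hmain⟩
end
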